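/- For n ≥ 2, p ∈ (0,1) and any θ₀ > 0, the number Y of isolated vertices in G(n,p) satisfies: P((Y-μ)/σ ≥ t) ≤ exp(-t²σ²/(μ γ_{θ₀/σ})) for all t ∈ [0, θ₀ μ γ_{θ₀/σ}/(2σ²)], and P((Y-μ)/σ ≥ t) ≤ exp(-θ₀ t + μ γ_{θ₀/σ} θ₀²/(4σ²)) for all t > θ₀ μ γ_{θ₀/σ}/(2σ²). -/

import Mathlib

open MeasureTheory ProbabilityTheory Real Finset

noncomputable section

namespace ErdosRenyiIsolated

/-- Index set for the potential edges of a graph on `Fin n`. -/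
abbrev EdgeIdx (n : ℕ) := {e : Fin n × Fin n // e.1 < e.2}

/-- Adjacency relation of the random graph encoded by `ω` : `u` and `v` are adjacent
if the corresponding edge indicator is `true`. -/
def adj {n : ℕ} (ω : EdgeIdx n → Bool) (u v : Fin n) : Prop :=
  if h : u < v then ω ⟨(u, v), h⟩ = true
  else if h' : v < u then ω ⟨(v, u), h'⟩ = true
  else False

instance {n : ℕ} (ω : EdgeIdx n → Bool) (u v : Fin n) : Decidable (adj ω u v) := by
  unfold adj
  split
  · exact inferInstance
  · split
    · exact inferInstance
    · exact inferInstance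

/-- Degree of vertex `v` in the graph encoded by `ω`. -/
def deg {n : ℕ} (ω : EdgeIdx n → Bool) (v : Fin n) : ℕ :=
  (Finset.univ.filter fun w => adj ω v w).card

/-- The number of isolated vertices of the graph encoded by `ω`. -/
def isolCount {n : ℕ} (ω : EdgeIdx n → Bool) : ℕ :=
  (Finset.univ.filter fun v => deg ω v = 0).card

/-- The Bernoulli(p) measure on `Bool`. -/
def bern (p : ℝ) : Measure Bool :=
  ENNReal.ofReal p • Measure.dirac true + ENNReal.ofReal (1 - p) • Measure.dirac false

instance (p : ℝ) : IsFiniteMeasure (bern p) := by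
  constructor
  have h : bern p Set.univ ≤ ENNReal.ofReal p + ENNReal.ofReal (1 - p) := by
    simp [bern]
  exact lt_of_le_of_lt h (ENNReal.add_lt_top.mpr ⟨ENNReal.ofReal_lt_top, ENNReal.ofReal_lt_top⟩)

/-- The Erdős–Rényi random graph measure `G(n,p)`: the edge indicators are i.i.d.
Bernoulli(p). -/
def gnp (n : ℕ) (p : ℝ) : Measure (EdgeIdx n → Bool) :=
  Measure.pi fun _ => bern p

/-- The Erdős–Rényi measure together with an independent uniformly chosen vertex. -/
def gnpV (n : ℕ) (p : ℝ) : Measure ((EdgeIdx n → Bool) × Fin n) :=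
  (gnp n p).prod (uniformOn (Set.univ : Set (Fin n)))

/-- Adjacency in the graph obtained by deleting all edges incident to `v'`. -/
def adjDel {n : ℕ} (ω : EdgeIdx n → Bool) (v' u v : Fin n) : Prop :=
  adj ω u v ∧ u ≠ v' ∧ v ≠ v'

instance {n : ℕ} (ω : EdgeIdx n → Bool) (v' u v : Fin n) : Decidable (adjDel ω v' u v) := by
  unfold adjDel; exact inferInstance

/-- Degree of `v` in the graph `ω` with all edges incident to `v'` deleted. -/
def degDel {n : ℕ} (ω : EdgeIdx n → Bool) (v' v : Fin n) : ℕ :=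
  (Finset.univ.filter fun w => adjDel ω v' v w).card

/-- Number of isolated vertices in the graph `ω` with all edges incident to `v'` deleted. -/
def isolCountDel {n : ℕ} (ω : EdgeIdx n → Bool) (v' : Fin n) : ℕ :=
  (Finset.univ.filter fun v => degDel ω v' v = 0).card

section ProductWeight

variable {ι : Type*} [Fintype ι]

/-- The probability of the configuration `ω` when its coordinates are i.i.d. Bernoulli(p). -/
def weight (p : ℝ) (ω : ι → Bool) : ℝ := ∏ i, if ω i then p else 1 - p

/-- The expectation of `f` when the coordinates are i.i.d. Bernoulli(p). -/
def expect [DecidableEq ι] (p : ℝ) (f : (ι → Bool) → ℝ) : ℝ := ∑ ω, weight p ω * f ω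

/-- The configuration `ω` with all coordinates in `A` switched off. -/
def switchOff [DecidableEq ι] (A : Finset ι) (ω : ι → Bool) : ι → Bool :=
  fun i => if i ∈ A then false else ω i

lemma weight_nonneg {p : ℝ} (hp : p ∈ Set.Ioo (0 : ℝ) 1) (ω : ι → Bool) : 0 ≤ weight p ω :=
  prod_nonneg fun i _ => by split_ifs <;> linarith [hp.1, hp.2]

variable [DecidableEq ι]

lemma expect_mono {p : ℝ} (hp : p ∈ Set.Ioo (0 : ℝ) 1) {f g : (ι → Bool) → ℝ}
    (h : ∀ ω, f ω ≤ g ω) : expect p f ≤ expect p g :=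
  sum_le_sum fun ω _ => mul_le_mul_of_nonneg_left (h ω) (weight_nonneg hp ω)

lemma expect_const_mul (p c : ℝ) (f : (ι → Bool) → ℝ) :
    expect p (fun ω => c * f ω) = c * expect p f := by
  simp only [expect, mul_sum]
  exact sum_congr rfl fun ω _ => by ring

lemma expect_add (p : ℝ) (f g : (ι → Bool) → ℝ) :
    expect p (fun ω => f ω + g ω) = expect p f + expect p g := by
  simp only [expect, mul_add, sum_add_distrib]

lemma expect_sub (p : ℝ) (f g : (ι → Bool) → ℝ) :
    expect p (fun ω => f ω - g ω) = expect p f - expect p g := by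
  simp only [expect, mul_sub, sum_sub_distrib]

lemma expect_sum {κ : Type*} (s : Finset κ) (p : ℝ) (f : κ → (ι → Bool) → ℝ) :
    expect p (fun ω => ∑ k ∈ s, f k ω) = ∑ k ∈ s, expect p (f k) := by
  simp only [expect, mul_sum]
  exact sum_comm

lemma expect_prod (p : ℝ) (f : ι → Bool → ℝ) :
    expect p (fun ω => ∏ i, f i (ω i)) = ∏ i, (p * f i true + (1 - p) * f i false) := by
  have h := Fintype.prod_sum (fun (i : ι) (b : Bool) => (if b then p else 1 - p) * f i b)
  simp only [Fintype.sum_bool] at h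
  simp only [expect, weight, ← prod_mul_distrib]
  rw [← h]
  simp

lemma expect_one (p : ℝ) : expect p (fun _ : ι → Bool => 1) = 1 := by
  have h := expect_prod p (fun (_ : ι) (_ : Bool) => 1)
  simpa using h

lemma hasDerivAt_expect (p : ℝ) {f f' : ℝ → (ι → Bool) → ℝ} {s : ℝ}
    (h : ∀ ω, HasDerivAt (fun x => f x ω) (f' s ω) s) :
    HasDerivAt (fun x => expect p (f x)) (expect p (f' s)) s := by
  unfold expect
  exact HasDerivAt.fun_sum fun ω _ => (h ω).const_mul _

/-- The exponential moment of the number of switched-on coordinates in `A`. -/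
lemma expect_exp_card (p s : ℝ) (A : Finset ι) :
    expect p (fun ω => exp (s * #{i ∈ A | ω i = true})) = (p * exp s + 1 - p) ^ #A := by
  have h := expect_prod p (fun (i : ι) (b : Bool) => if i ∈ A ∧ b = true then exp s else 1)
  have hL : ∀ ω : ι → Bool, exp (s * #{i ∈ A | ω i = true})
      = ∏ i, if i ∈ A ∧ ω i = true then exp s else 1 := by
    intro ω
    rw [prod_ite, prod_const, prod_const_one, mul_one, mul_comm, exp_nat_mul]
    congr 2
    ext i
    simp
  have hR : ∀ i : ι, (p * (if i ∈ A ∧ true = true then exp s else 1)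
      + (1 - p) * (if i ∈ A ∧ false = true then exp s else 1))
      = if i ∈ A then p * exp s + 1 - p else 1 := by
    intro i
    by_cases hi : i ∈ A <;> simp [hi]
    ring
  rw [funext hL, h, prod_congr rfl fun i _ => hR i, prod_ite_mem, univ_inter, prod_const]

lemma expect_card_mul_exp_card (p s : ℝ) (A : Finset ι) :
    expect p (fun ω => #{i ∈ A | ω i = true} * exp (s * #{i ∈ A | ω i = true}))
      = #A * (p * exp s + 1 - p) ^ (#A - 1) * (p * exp s) := by
  have h₁ := hasDerivAt_expect p (s := s)
    (f := fun x ω => exp (x * #{i ∈ A | ω i = true}))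
    (f' := fun x ω => #{i ∈ A | ω i = true} * exp (x * #{i ∈ A | ω i = true})) fun ω => by
      have := ((hasDerivAt_id s).mul_const (#{i ∈ A | ω i = true} : ℝ)).exp
      simpa [mul_comm] using this
  simp only [expect_exp_card] at h₁
  refine h₁.unique ?_
  have := ((((Real.hasDerivAt_exp s).const_mul p).add_const 1).sub_const p).fun_pow #A
  exact this

/-- The Harris inequality for a nonnegative increasing and a decreasing function. -/
lemma expect_mul_le_of_monotone_of_antitone {p : ℝ} (hp : p ∈ Set.Ioo (0 : ℝ) 1)
    {f g : (ι → Bool) → ℝ} (hf₀ : ∀ ω, 0 ≤ f ω) (hf : Monotone f) (hg : Antitone g) :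
    expect p (fun ω => f ω * g ω) ≤ expect p f * expect p g := by
  have hfkg := fkg (μ := weight p) (f := f) (g := fun ω => g ⊥ - g ω)
    (fun ω => weight_nonneg hp ω) hf₀
    (fun ω => sub_nonneg.2 (hg bot_le)) hf (fun a b hab => sub_le_sub_left (hg hab) _)
    (fun a b => by
      simp only [weight, ← prod_mul_distrib]
      refine (prod_congr rfl fun i _ => ?_).le
      cases ha : a i <;> cases hb : b i <;> simp [ha, hb, mul_comm])
  have h1 : expect p (fun ω => g ⊥ - g ω) = g ⊥ - expect p g := by
    have := expect_const_mul p (g ⊥) (fun _ : ι → Bool => 1)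
    simp only [expect_one, mul_one] at this
    rw [expect_sub, this]
  have h2 : expect p (fun ω => f ω * (g ⊥ - g ω))
      = g ⊥ * expect p f - expect p (fun ω => f ω * g ω) := by
    rw [← expect_const_mul, ← expect_sub]
    congr 1
    ext ω
    ring
  have h3 := expect_one (ι := ι) p
  simp only [expect, mul_one] at h1 h2 h3 hfkg ⊢
  rw [h1, h2, h3] at hfkg
  linarith

lemma expect_ite_update (p : ℝ) (e : ι) (f : (ι → Bool) → ℝ) :
    expect p (fun ω => if ω e = false then f ω else 0)
      = (1 - p) * expect p (fun ω => f (Function.update ω e false)) := by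
  have key : ∀ F : (ι → Bool) → ℝ, expect p F = ∑ x : {j // j ≠ e} → Bool,
      (∏ j, if x j then p else 1 - p) * (p * F ((Equiv.funSplitAt e Bool).symm (true, x))
        + (1 - p) * F ((Equiv.funSplitAt e Bool).symm (false, x))) := by
    intro F
    have hw : ∀ (b : Bool) (x : {j // j ≠ e} → Bool),
        weight p ((Equiv.funSplitAt e Bool).symm (b, x))
          = (if b then p else 1 - p) * ∏ j, if x j then p else 1 - p := by
      intro b x
      rw [weight, Fintype.prod_eq_mul_prod_subtype_ne _ e]
      congr 1
      · simp [Equiv.funSplitAt, Equiv.piSplitAt]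
      · refine prod_congr rfl fun j _ => ?_
        simp [Equiv.funSplitAt, Equiv.piSplitAt, j.2]
    rw [expect, ← (Equiv.funSplitAt e Bool).symm.sum_comp, Fintype.sum_prod_type, sum_comm]
    refine sum_congr rfl fun x _ => ?_
    simp only [Fintype.sum_bool, hw]
    simp
    ring
  rw [key, key, mul_sum]
  refine sum_congr rfl fun x _ => ?_
  have hu : ∀ b, Function.update ((Equiv.funSplitAt e Bool).symm (b, x)) e false
      = (Equiv.funSplitAt e Bool).symm (false, x) := by
    intro b
    ext j
    by_cases hj : j = e
    · subst hj; simp [Equiv.funSplitAt, Equiv.piSplitAt]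
    · simp [Equiv.funSplitAt, Equiv.piSplitAt, hj]
  have ht : ∀ b, (Equiv.funSplitAt e Bool).symm (b, x) e = b := by
    intro b
    simp [Equiv.funSplitAt, Equiv.piSplitAt]
  simp only [hu, ht]
  simp
  ring

/-- Conditioning on all coordinates in `A` being off amounts to switching them off. -/
lemma expect_ite_switchOff (p : ℝ) (A : Finset ι) (f : (ι → Bool) → ℝ) :
    expect p (fun ω => if ∀ i ∈ A, ω i = false then f ω else 0)
      = (1 - p) ^ #A * expect p (fun ω => f (switchOff A ω)) := by
  induction A using Finset.induction_on generalizing f with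
  | empty =>
    have h : ∀ ω : ι → Bool, switchOff ∅ ω = ω := fun ω => by ext i; simp [switchOff]
    simp [h]
  | insert e A he ih =>
    have h1 : (fun ω : ι → Bool => if ∀ i ∈ insert e A, ω i = false then f ω else 0)
        = fun ω => if ∀ i ∈ A, ω i = false then (if ω e = false then f ω else 0) else 0 := by
      ext ω
      simp only [forall_mem_insert]
      split_ifs <;> simp_all
    have h2 : (fun ω : ι → Bool =>
        if switchOff A ω e = false then f (switchOff A ω) else 0)
        = fun ω => if ω e = false then f (switchOff A ω) else 0 := by
      ext ω
      simp [switchOff, he]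
    have h3 : ∀ ω, switchOff A (Function.update ω e false) = switchOff (insert e A) ω := by
      intro ω
      ext i
      by_cases hi : i = e <;> simp [switchOff, hi]
    rw [h1, ih, h2, expect_ite_update, card_insert_of_notMem he, pow_succ]
    simp only [h3]
    ring

end ProductWeight

/-- The potential edges incident to `v`. -/
def incident {n : ℕ} (v : Fin n) : Finset (EdgeIdx n) := {e | e.1.1 = v ∨ e.1.2 = v}

lemma adj_iff_exists_edge {n : ℕ} (ω : EdgeIdx n → Bool) (v w : Fin n) :
    adj ω v w ↔ ∃ e : EdgeIdx n, ω e = true ∧ (e.1 = (v, w) ∨ e.1 = (w, v)) := by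
  unfold adj
  constructor
  · intro h
    split_ifs at h with h₁ h₂
    · exact ⟨_, h, Or.inl rfl⟩
    · exact ⟨_, h, Or.inr rfl⟩
  · rintro ⟨⟨⟨a, b⟩, hab⟩, he, h | h⟩
    · obtain ⟨rfl, rfl⟩ := Prod.mk.inj h
      simpa [show a < b from hab] using he
    · obtain ⟨rfl, rfl⟩ := Prod.mk.inj h
      simpa [show a < b from hab, (show a < b from hab).not_gt] using he

lemma deg_eq_card_incident {n : ℕ} (ω : EdgeIdx n → Bool) (v : Fin n) :
    deg ω v = #{e ∈ incident v | ω e = true} := by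
  symm
  refine card_bij (fun e _ => if e.1.1 = v then e.1.2 else e.1.1) ?_ ?_ ?_
  · rintro ⟨⟨a, b⟩, hab⟩ he
    simp only [incident, mem_filter, mem_univ, true_and] at he ⊢
    rw [adj_iff_exists_edge]
    refine ⟨_, he.2, ?_⟩
    rcases he.1 with rfl | rfl
    · simp
    · simp [(show a < b from hab).ne]
  · rintro ⟨⟨a, b⟩, hab⟩ he ⟨⟨c, d⟩, hcd⟩ hf h
    simp only [incident, mem_filter, mem_univ, true_and] at he hf h hab hcd
    simp only [Subtype.mk.injEq, Prod.mk.injEq]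
    split_ifs at h <;> grind
  · intro w hw
    simp only [mem_filter, mem_univ, true_and, adj_iff_exists_edge] at hw
    obtain ⟨⟨⟨a, b⟩, hab⟩, he, h | h⟩ := hw
    · obtain ⟨rfl, rfl⟩ := Prod.mk.inj h
      exact ⟨⟨(a, b), hab⟩, by simp [incident, he], by simp⟩
    · obtain ⟨rfl, rfl⟩ := Prod.mk.inj h
      exact ⟨⟨(a, b), hab⟩, by simp [incident, he], by simp [(show a < b from hab).ne]⟩

lemma card_incident {n : ℕ} (v : Fin n) : #(incident v) = n - 1 := by
  have h := deg_eq_card_incident (fun _ : EdgeIdx n => true) v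
  have h' : (univ.filter fun w => adj (fun _ : EdgeIdx n => true) v w) = univ.erase v := by
    ext w
    rcases lt_trichotomy v w with hw | hw | hw
    · simp [adj, hw, hw.ne']
    · simp [adj, hw]
    · simp [adj, hw, hw.ne]
  rw [deg, h', card_erase_of_mem (mem_univ v), card_univ, Fintype.card_fin] at h
  simpa using h.symm

lemma deg_eq_zero_iff {n : ℕ} (ω : EdgeIdx n → Bool) (v : Fin n) :
    deg ω v = 0 ↔ ∀ e ∈ incident v, ω e = false := by
  simp [deg_eq_card_incident, filter_eq_empty_iff]

lemma deg_mono {n : ℕ} (v : Fin n) : Monotone fun ω : EdgeIdx n → Bool => deg ω v := by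
  intro ω ω' h
  simp only [deg_eq_card_incident]
  exact card_le_card fun e he => by
    simp only [mem_filter] at he ⊢
    exact ⟨he.1, h e he.2⟩

lemma isolCount_antitone {n : ℕ} : Antitone fun ω : EdgeIdx n → Bool => isolCount ω := by
  intro ω ω' h
  refine card_le_card fun v hv => ?_
  simp only [mem_filter, mem_univ, true_and] at hv ⊢
  exact Nat.le_zero.1 (hv ▸ deg_mono v h)

lemma isolCount_le_isolCount_switchOff {n : ℕ} (ω : EdgeIdx n → Bool) (v : Fin n) :
    isolCount ω ≤ isolCount (switchOff (incident v) ω) :=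
  isolCount_antitone fun e => by
    unfold switchOff
    split_ifs
    · exact Bool.false_le _
    · exact le_rfl

lemma isolCount_switchOff_le {n : ℕ} (ω : EdgeIdx n → Bool) (v : Fin n) :
    isolCount (switchOff (incident v) ω) ≤ isolCount ω + (deg ω v + 1) := by
  have hsub : (univ.filter fun w => deg (switchOff (incident v) ω) w = 0)
      ⊆ (univ.filter fun w => deg ω w = 0) ∪ insert v (univ.filter fun w => adj ω v w) := by
    intro w hw
    simp only [mem_filter, mem_univ, true_and, mem_union, mem_insert] at hw ⊢
    by_contra! hcon
    obtain ⟨h₁, h₂, h₃⟩ := hcon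
    refine h₁ ((deg_eq_zero_iff _ _).2 fun e he => ?_)
    have hoff := (deg_eq_zero_iff _ _).1 hw e he
    by_cases hev : e ∈ incident v
    · by_contra hωe
      refine h₃ ((adj_iff_exists_edge _ _ _).2 ⟨e, by simpa using hωe, ?_⟩)
      simp only [incident, mem_filter, mem_univ, true_and] at he hev
      simp only [Prod.ext_iff]
      grind
    · simpa [switchOff, hev] using hoff
  calc isolCount (switchOff (incident v) ω)
      ≤ _ := card_le_card hsub
    _ ≤ _ := card_union_le _ _
    _ ≤ _ := Nat.add_le_add_left (card_insert_le _ _) _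

/-- The size bias identity for the number of isolated vertices. -/
lemma expect_isolCount_mul {n : ℕ} (p : ℝ) (f : (EdgeIdx n → Bool) → ℝ) :
    expect p (fun ω => isolCount ω * f ω)
      = ∑ v : Fin n, (1 - p) ^ (n - 1) * expect p (fun ω => f (switchOff (incident v) ω)) := by
  have h : (fun ω : EdgeIdx n → Bool => (isolCount ω : ℝ) * f ω)
      = fun ω => ∑ v : Fin n, if ∀ e ∈ incident v, ω e = false then f ω else 0 := by
    ext ω
    simp only [isolCount, deg_eq_zero_iff, card_filter, Nat.cast_sum, sum_mul]
    exact sum_congr rfl fun v _ => by split_ifs <;> simp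
  rw [h, expect_sum]
  exact sum_congr rfl fun v _ => by rw [expect_ite_switchOff, card_incident]

/-- The exponential-moment constant `γ_s`. -/
def gammaConst (n : ℕ) (p s : ℝ) : ℝ :=
  exp s * (p * exp s + 1 - p) ^ (n - 2) * (n * p * exp s + 1 - p) + ((n : ℝ) - 1) * p + 1

lemma gammaConst_mono {n : ℕ} {p : ℝ} (hp : p ∈ Set.Ioo (0 : ℝ) 1) :
    Monotone (gammaConst n p) := by
  intro s s' h
  have h₁ : 0 ≤ p := hp.1.le
  have h₂ : 0 < 1 - p := sub_pos.2 hp.2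
  have h₃ : 0 ≤ p * exp s + 1 - p := by have := mul_nonneg h₁ (exp_pos s).le; linarith
  have h₄ : 0 ≤ n * p * exp s + 1 - p := by
    have : 0 ≤ n * p * exp s := by positivity
    linarith
  have h₅ : 0 ≤ p * exp s' + 1 - p := by have := mul_nonneg h₁ (exp_pos s').le; linarith
  unfold gammaConst
  gcongr

lemma gammaConst_pos {n : ℕ} (hn : 2 ≤ n) {p : ℝ} (hp : p ∈ Set.Ioo (0 : ℝ) 1) (s : ℝ) :
    0 < gammaConst n p s := by
  have h₁ : 0 < p := hp.1
  have h₂ : 0 < 1 - p := sub_pos.2 hp.2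
  have h₃ : 0 < p * exp s + 1 - p := by have := mul_pos h₁ (exp_pos s); linarith
  have h₄ : 0 < n * p * exp s + 1 - p := by
    have : 0 ≤ n * p * exp s := by positivity
    linarith
  have h₅ : 0 ≤ (n : ℝ) - 1 := by
    have : (2 : ℝ) ≤ n := by exact_mod_cast hn
    linarith
  unfold gammaConst
  positivity

lemma expect_deg_add_one_mul {n : ℕ} (hn : 2 ≤ n) (p s : ℝ) (v : Fin n) :
    expect p (fun ω : EdgeIdx n → Bool =>
      ((deg ω v : ℝ) + 1) * (exp (s * ((deg ω v : ℝ) + 1)) + 1)) = gammaConst n p s := by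
  have h₁ := expect_exp_card p s (incident v)
  have h₂ := expect_card_mul_exp_card p s (incident v)
  have h₃ := expect_card_mul_exp_card p 0 (incident v)
  simp only [← deg_eq_card_incident, card_incident] at h₁ h₂ h₃
  have h₀ := expect_one (ι := EdgeIdx n) p
  have hsplit : (fun ω : EdgeIdx n → Bool =>
      ((deg ω v : ℝ) + 1) * (exp (s * ((deg ω v : ℝ) + 1)) + 1))
      = fun ω => exp s * (deg ω v * exp (s * deg ω v)) + exp s * exp (s * deg ω v)
        + (deg ω v * exp (0 * deg ω v) + 1) := by
    ext ω
    rw [mul_add s, mul_one, exp_add, zero_mul, exp_zero]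
    ring
  rw [hsplit, expect_add, expect_add, expect_add, expect_const_mul, expect_const_mul, h₀, h₁, h₂,
    h₃, gammaConst]
  obtain ⟨m, rfl⟩ := Nat.exists_eq_add_of_le' hn
  simp only [Nat.add_sub_cancel, show m + 2 - 1 = m + 1 by omega, exp_zero]
  push_cast
  ring

lemma exp_sub_one_le {u : ℝ} (hu : 0 ≤ u) : exp u - 1 ≤ u * (exp u + 1) / 2 := by
  have hd : ∀ x, HasDerivAt (fun x => x * (exp x + 1) / 2 - (exp x - 1))
      ((1 * (exp x + 1) + x * exp x) / 2 - exp x) x := fun x =>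
    (((hasDerivAt_id x).mul ((Real.hasDerivAt_exp x).add_const 1)).div_const 2).sub
      ((Real.hasDerivAt_exp x).sub_const 1)
  have hmono : Monotone (fun x => x * (exp x + 1) / 2 - (exp x - 1)) := by
    refine monotone_of_deriv_nonneg (fun x => (hd x).differentiableAt) fun x => ?_
    rw [(hd x).deriv]
    have h₁ : exp x * exp (-x) = 1 := by rw [← exp_add]; simp
    nlinarith [add_one_le_exp (-x), exp_pos x]
  have h := hmono hu
  simp at h
  linarith

lemma exp_sub_exp_le {s x y d : ℝ} (hs : 0 ≤ s) (hxy : x ≤ y) (hyd : y ≤ x + d) :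
    exp (s * y) - exp (s * x) ≤ s / 2 * ((d * (exp (s * d) + 1)) * exp (s * x)) := by
  have hd : 0 ≤ d := by linarith
  have hle : s * (y - x) ≤ s * d := mul_le_mul_of_nonneg_left (by linarith) hs
  have h₁ : exp (s * y) - exp (s * x) = (exp (s * (y - x)) - 1) * exp (s * x) := by
    rw [sub_mul, ← exp_add]
    ring_nf
  have h₂ : exp (s * (y - x)) - 1 ≤ s * d * (exp (s * d) + 1) / 2 :=
    calc exp (s * (y - x)) - 1 ≤ exp (s * d) - 1 := by gcongr
      _ ≤ _ := exp_sub_one_le (mul_nonneg hs hd)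
  rw [h₁]
  calc _ ≤ s * d * (exp (s * d) + 1) / 2 * exp (s * x) := by gcongr
    _ = _ := by ring

lemma expect_isolCount_mul_exp_le {n : ℕ} (hn : 2 ≤ n) {p : ℝ} (hp : p ∈ Set.Ioo (0 : ℝ) 1)
    {s : ℝ} (hs : 0 ≤ s) :
    expect p (fun ω : EdgeIdx n → Bool => isolCount ω * exp (s * isolCount ω))
      ≤ n * (1 - p) ^ (n - 1) * (1 + s / 2 * gammaConst n p s)
        * expect p (fun ω : EdgeIdx n → Bool => exp (s * isolCount ω)) := by
  have hq : 0 ≤ 1 - p := sub_nonneg.2 hp.2.le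
  have hvertex : ∀ v : Fin n,
      expect p (fun ω : EdgeIdx n → Bool => exp (s * isolCount (switchOff (incident v) ω)))
        ≤ (1 + s / 2 * gammaConst n p s)
          * expect p (fun ω : EdgeIdx n → Bool => exp (s * isolCount ω)) := by
    intro v
    have hdiff := expect_mono hp fun ω : EdgeIdx n → Bool => exp_sub_exp_le (d := deg ω v + 1) hs
      (Nat.cast_le.2 (isolCount_le_isolCount_switchOff ω v))
      (by exact_mod_cast isolCount_switchOff_le ω v)
    rw [expect_sub, expect_const_mul] at hdiff
    have hharris := expect_mul_le_of_monotone_of_antitone hp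
      (f := fun ω : EdgeIdx n → Bool =>
        ((deg ω v : ℝ) + 1) * (exp (s * ((deg ω v : ℝ) + 1)) + 1))
      (g := fun ω => exp (s * isolCount ω)) (fun ω => by positivity)
      (fun ω ω' h => by
        have hdeg : deg ω v ≤ deg ω' v := deg_mono v h
        dsimp only
        gcongr)
      (fun ω ω' h => by
        have hiso : isolCount ω' ≤ isolCount ω := isolCount_antitone h
        dsimp only
        gcongr)
    rw [expect_deg_add_one_mul hn] at hharris
    have := mul_le_mul_of_nonneg_left hharris (by positivity : 0 ≤ s / 2)
    linarith
  rw [expect_isolCount_mul]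
  calc _ ≤ ∑ _v : Fin n, (1 - p) ^ (n - 1) * ((1 + s / 2 * gammaConst n p s)
          * expect p (fun ω : EdgeIdx n → Bool => exp (s * isolCount ω))) :=
        sum_le_sum fun v _ => mul_le_mul_of_nonneg_left (hvertex v) (by positivity)
    _ = _ := by
      rw [sum_const, card_univ, Fintype.card_fin, nsmul_eq_mul]
      ring

lemma expect_exp_isolCount_le {n : ℕ} (hn : 2 ≤ n) {p : ℝ} (hp : p ∈ Set.Ioo (0 : ℝ) 1)
    {s s₀ : ℝ} (hs : 0 ≤ s) (hs₀ : s ≤ s₀) :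
    expect p (fun ω : EdgeIdx n → Bool => exp (s * isolCount ω))
      ≤ exp (n * (1 - p) ^ (n - 1) * (s + gammaConst n p s₀ * s ^ 2 / 4)) := by
  set μ : ℝ := n * (1 - p) ^ (n - 1) with hμ
  set c := gammaConst n p s₀ with hc
  have hμ₀ : 0 ≤ μ := mul_nonneg n.cast_nonneg (pow_nonneg (sub_nonneg.2 hp.2.le) _)
  set L : ℝ → ℝ := fun x => expect p (fun ω : EdgeIdx n → Bool => exp (x * isolCount ω)) with hL
  set L' : ℝ → ℝ :=
    fun x => expect p (fun ω : EdgeIdx n → Bool => isolCount ω * exp (x * isolCount ω)) with hL'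
  have hdL : ∀ x, HasDerivAt L (L' x) x := fun x => by
    refine hasDerivAt_expect p (f := fun x (ω : EdgeIdx n → Bool) => exp (x * isolCount ω))
      (f' := fun x ω => isolCount ω * exp (x * isolCount ω)) fun ω => ?_
    have := ((hasDerivAt_id x).mul_const (isolCount ω : ℝ)).exp
    simpa [mul_comm] using this
  have hdE : ∀ x, HasDerivAt (fun x => exp (-(μ * (x + c * x ^ 2 / 4))))
      (exp (-(μ * (x + c * x ^ 2 / 4))) * -(μ * (1 + c * x / 2))) x := fun x => by
    have h : HasDerivAt (fun x : ℝ => x + c * x ^ 2 / 4) (1 + c * x / 2) x :=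
      ((hasDerivAt_id x).fun_add (((hasDerivAt_pow 2 x).const_mul c).div_const 4)).congr_deriv (by
        push_cast
        ring)
    exact (h.const_mul μ).fun_neg.exp
  have hd := fun x => (hdL x).fun_mul (hdE x)
  have hanti : AntitoneOn (fun x => L x * exp (-(μ * (x + c * x ^ 2 / 4)))) (Set.Icc 0 s₀) := by
    refine antitoneOn_of_deriv_nonpos (convex_Icc _ _)
      (fun x _ => (hd x).continuousAt.continuousWithinAt)
      (fun x _ => (hd x).differentiableAt.differentiableWithinAt) fun x hx => ?_
    rw [interior_Icc] at hx
    rw [(hd x).deriv]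
    have h₁ : L' x ≤ μ * (1 + x / 2 * gammaConst n p x) * L x :=
      expect_isolCount_mul_exp_le hn hp hx.1.le
    have hLx : 0 ≤ L x := sum_nonneg fun ω _ => mul_nonneg (weight_nonneg hp ω) (exp_pos _).le
    have h₂ : μ * (1 + x / 2 * gammaConst n p x) * L x ≤ μ * (1 + x / 2 * c) * L x := by
      have := gammaConst_mono (n := n) hp hx.2.le
      have hx0 := hx.1.le
      gcongr
    have h₃ : L' x - μ * (1 + x / 2 * c) * L x ≤ 0 := by linarith
    calc _ = (L' x - μ * (1 + x / 2 * c) * L x) * exp (-(μ * (x + c * x ^ 2 / 4))) := by ring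
      _ ≤ 0 := mul_nonpos_of_nonpos_of_nonneg h₃ (exp_pos _).le
  have h := hanti ⟨le_rfl, hs.trans hs₀⟩ ⟨hs, hs₀⟩ hs
  have hL0 : L 0 = 1 := by simp [hL, expect_one]
  simp only [hL0] at h
  rw [exp_neg, ← div_eq_mul_inv, div_le_iff₀ (exp_pos _)] at h
  simpa using h

lemma gnp_toReal_eq_expect {n : ℕ} {p : ℝ} (hp : p ∈ Set.Ioo (0 : ℝ) 1)
    (S : Set (EdgeIdx n → Bool)) [DecidablePred (· ∈ S)] :
    (gnp n p S).toReal = expect p (fun ω => if ω ∈ S then 1 else 0) := by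
  have hsingle : ∀ ω : EdgeIdx n → Bool, (gnp n p {ω}).toReal = weight p ω := by
    intro ω
    rw [gnp, Measure.pi_singleton, ENNReal.toReal_prod, weight]
    refine prod_congr rfl fun e _ => ?_
    cases ω e <;> simp [bern, hp.1.le, hp.2.le]
  have : IsFiniteMeasure (gnp n p) := by unfold gnp; infer_instance
  have h := sum_measureReal_singleton (μ := gnp n p) (univ.filter (· ∈ S))
  simp only [coe_filter, mem_univ, true_and, Set.ofPred_mem_eq, Measure.real, hsingle] at h
  rw [← h, sum_filter, expect]
  simp

/-- The Chernoff bound at a parameter `θ ∈ [0, θ₀]`. -/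
lemma gnp_right_tail_le {n : ℕ} (hn : 2 ≤ n) {p : ℝ} (hp : p ∈ Set.Ioo (0 : ℝ) 1)
    {σ θ θ₀ : ℝ} (hσ : 0 < σ) (hθ : 0 ≤ θ) (hθ₀ : θ ≤ θ₀) (t : ℝ) :
    (gnp n p {ω | t ≤ ((isolCount ω : ℝ) - n * (1 - p) ^ (n - 1)) / σ}).toReal
      ≤ exp (-θ * t + n * (1 - p) ^ (n - 1) * gammaConst n p (θ₀ / σ) * θ ^ 2 / (4 * σ ^ 2)) := by
  classical
  set μ : ℝ := n * (1 - p) ^ (n - 1) with hμ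
  have hmgf := expect_exp_isolCount_le hn hp (s := θ / σ) (s₀ := θ₀ / σ) (by positivity)
    (by gcongr)
  rw [gnp_toReal_eq_expect hp]
  calc _ ≤ expect p (fun ω : EdgeIdx n → Bool =>
          exp (-θ * t - θ / σ * μ) * exp (θ / σ * isolCount ω)) := by
        refine expect_mono hp fun ω => ?_
        rw [← exp_add]
        split_ifs with h
        · rw [Set.mem_ofPred_eq] at h
          refine one_le_exp ?_
          have := mul_le_mul_of_nonneg_left h hθ
          calc (0 : ℝ) ≤ θ * (((isolCount ω : ℝ) - μ) / σ) - θ * t := by linarith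
            _ = _ := by ring
        · positivity
    _ = exp (-θ * t - θ / σ * μ)
          * expect p (fun ω : EdgeIdx n → Bool => exp (θ / σ * isolCount ω)) :=
        expect_const_mul _ _ _
    _ ≤ exp (-θ * t - θ / σ * μ)
          * exp (μ * (θ / σ + gammaConst n p (θ₀ / σ) * (θ / σ) ^ 2 / 4)) := by gcongr
    _ = _ := by
        rw [← exp_add]
        congr 1
        field_simp
        ring

/-- explicit two-regime right tail bounds obtained by restricting the
Chernoff argument to `θ ∈ [0, θ₀]`. -/
theorem right_tail_two_regimes (n : ℕ) (hn : 2 ≤ n) (p : ℝ) (hp : p ∈ Set.Ioo (0 : ℝ) 1)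
    (μ σ : ℝ) (hμ : μ = (n : ℝ) * (1 - p) ^ (n - 1))
    (hσ : σ = Real.sqrt ((n : ℝ) * (1 - p) ^ (n - 1)
      * (1 + (n : ℝ) * p * (1 - p) ^ (n - 2) - (1 - p) ^ (n - 2))))
    (γ : ℝ → ℝ)
    (hγ : ∀ s, γ s = Real.exp s * (p * Real.exp s + 1 - p) ^ (n - 2)
      * ((n : ℝ) * p * Real.exp s + 1 - p) + ((n : ℝ) - 1) * p + 1)
    (θ₀ : ℝ) (hθ₀ : 0 < θ₀) :
    (∀ t : ℝ, 0 ≤ t → t ≤ θ₀ * μ * γ (θ₀ / σ) / (2 * σ ^ 2) →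
      ((gnp n p) {ω | t ≤ ((isolCount ω : ℝ) - μ) / σ}).toReal
        ≤ Real.exp (-(t ^ 2 * σ ^ 2) / (μ * γ (θ₀ / σ)))) ∧
    (∀ t : ℝ, θ₀ * μ * γ (θ₀ / σ) / (2 * σ ^ 2) < t →
      ((gnp n p) {ω | t ≤ ((isolCount ω : ℝ) - μ) / σ}).toReal
        ≤ Real.exp (-θ₀ * t + μ * γ (θ₀ / σ) * θ₀ ^ 2 / (4 * σ ^ 2))) := by
  obtain rfl : γ = gammaConst n p := funext hγ
  have hq : 0 < 1 - p := sub_pos.2 hp.2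
  have hn₀ : (0 : ℝ) < n := by exact_mod_cast (by omega : 0 < n)
  have hμ₀ : 0 < μ := hμ ▸ mul_pos hn₀ (pow_pos hq _)
  have hσ₀ : 0 < σ := by
    have h₁ : (1 - p) ^ (n - 2) ≤ 1 := pow_le_one₀ hq.le (by linarith [hp.1])
    have h₂ : 0 < (n : ℝ) * p * (1 - p) ^ (n - 2) := mul_pos (mul_pos hn₀ hp.1) (pow_pos hq _)
    rw [hσ]
    exact sqrt_pos.2 (mul_pos (mul_pos hn₀ (pow_pos hq _)) (by linarith))
  have hc : 0 < gammaConst n p (θ₀ / σ) := gammaConst_pos hn hp _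
  rw [← hμ] at hσ
  have htail : ∀ θ, 0 ≤ θ → θ ≤ θ₀ → ∀ t,
      ((gnp n p) {ω | t ≤ ((isolCount ω : ℝ) - μ) / σ}).toReal
        ≤ exp (-θ * t + μ * gammaConst n p (θ₀ / σ) * θ ^ 2 / (4 * σ ^ 2)) := by
    rw [hμ]
    exact fun θ hθ hθ' t => gnp_right_tail_le hn hp hσ₀ hθ hθ' t
  refine ⟨fun t ht ht' => ?_, fun t _ => htail θ₀ hθ₀.le le_rfl t⟩
  refine (htail (2 * σ ^ 2 * t / (μ * gammaConst n p (θ₀ / σ))) (by positivity) ?_ t).trans_eq ?_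
  · rw [le_div_iff₀ (by positivity)] at ht'
    rw [div_le_iff₀ (by positivity)]
    linarith
  · congr 1
    field_simp
    ring

end ErdosRenyiIsolated
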